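/- arXiv:1710.02241 — 2 statements merged into one kernel-verified Lean document; each statement's English description precedes it below -/
import Mathlib

section
/- MacMahon's box formula as the a = 1 specialization of Kamioka's formula: for all nonnegative integers r, c, n, the following identity holds in ℚ(q): the sum over all plane partitions π in P(r,c,n) of q^{|π|} equals the triple product ∏_{i=1}^{r} ∏_{j=1}^{c} ∏_{k=1}^{n} (1 - q^{i+j+k-1}) / (1 - q^{i+j+k-2}). -/
open Finset

noncomputable section

/-- A plane partition with at most `r` rows and at most `c` columns, viewed as a map
`ℕ≥1 × ℕ≥1 → ℕ` (encoded as a map `ℕ × ℕ → ℕ` vanishing at indices `0`), weakly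
decreasing along rows and columns, with `π i j = 0` whenever `i > r` or `j > c`. -/
def IsPlanePartition (r c : ℕ) (π : ℕ → ℕ → ℕ) : Prop :=
  (∀ i j, 1 ≤ i → 1 ≤ j → π i (j + 1) ≤ π i j) ∧
  (∀ i j, 1 ≤ i → 1 ≤ j → π (i + 1) j ≤ π i j) ∧
  (∀ i j, r < i ∨ c < j → π i j = 0) ∧
  (∀ i j, i = 0 ∨ j = 0 → π i j = 0)

/-- `P(r,c,n)`: plane partitions with at most `r` rows, at most `c` columns,
and all parts at most `n`. -/
def boxPP (r c n : ℕ) : Set (ℕ → ℕ → ℕ) :=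
  {π | IsPlanePartition r c π ∧ ∀ i j, π i j ≤ n}

/-- The norm `|π| = Σ_{i,j} π_{i,j}` of a plane partition. -/
def ppNorm (π : ℕ → ℕ → ℕ) : ℕ := ∑ᶠ i, ∑ᶠ j, π i j

section Determinants

variable {K : Type*} [Field K]

/-- The Vandermonde determinant as a double product over ranges. -/
lemma det_vandermonde_eq_prod_range (m : ℕ) (y : ℕ → K) :
    (Matrix.vandermonde fun i : Fin m => y i).det =
      ∏ j ∈ range m, ∏ i ∈ range j, (y j - y i) := by
  rw [Matrix.det_vandermonde, prod_comm' (t' := univ) (s' := Iio) (by simp),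
    ← Fin.prod_univ_eq_prod_range fun j => ∏ i ∈ range j, (y j - y i)]
  refine prod_congr rfl fun j _ => ?_
  rw [← Nat.Iio_eq_range, ← Fin.map_valEmbedding_Iio, prod_map]
  rfl

/-- Subtracting consecutive rows of a Vandermonde matrix. -/
lemma det_pow_succ_sub_pow_succ (m : ℕ) (y : ℕ → K) :
    (Matrix.of fun i j : Fin m => y (i + 1) ^ (j + 1 : ℕ) - y i ^ (j + 1 : ℕ)).det =
      (Matrix.vandermonde fun i : Fin (m + 1) => y i).det := by
  have h : (Matrix.vandermonde fun i : Fin (m + 1) => y i).det =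
      (Matrix.of (Fin.cons (fun j : Fin (m + 1) => y 0 ^ (j : ℕ)) fun (i : Fin m) j =>
        y (i + 1) ^ (j : ℕ) - y i ^ (j : ℕ)) : Matrix (Fin (m + 1)) (Fin (m + 1)) K).det := by
    refine Matrix.det_eq_of_forall_row_eq_smul_add_pred (fun _ => 1) ?_ ?_
    · intro j; simp [Matrix.vandermonde_apply]
    · intro i j; simp [Matrix.vandermonde_apply]
  rw [h, Matrix.det_succ_column_zero, Fin.sum_univ_succ]
  simp
  rfl

/-- A sum of determinants over a box, with the `i`-th row depending only on the `i`-th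
coordinate. -/
lemma sum_piFinset_det (m : ℕ) (s : Fin m → Finset ℕ) (f : Fin m → Fin m → ℕ → K) :
    ∑ b ∈ Fintype.piFinset s, (Matrix.of fun i j => f i j (b i)).det =
      (Matrix.of fun i j => ∑ x ∈ s i, f i j x).det := by
  rw [← Matrix.det_transpose]
  simp_rw [← Matrix.det_transpose (Matrix.of fun i j => f i j _), Matrix.det_apply]
  rw [sum_comm]
  refine sum_congr rfl fun σ _ => ?_
  rw [← smul_sum]
  simp [prod_univ_sum]

lemma sum_Icc_pow_mul (q : K) (p s i j : ℕ) (h : p ≤ s) :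
    (∑ x ∈ Icc p s, (q ^ (x + i)) ^ j) * (q ^ j - 1) =
      (q ^ (s + (i + 1))) ^ j - (q ^ (p + i)) ^ j := by
  induction s, h using Nat.le_induction with
  | base => simp; ring
  | succ s h ih =>
    rw [sum_Icc_succ_top (by omega), add_mul, ih]
    ring

end Determinants

section TriangularArrays

variable {K : Type*} [Field K]

/-- Extension of a finite sequence by zero. -/
def extendZero {m : ℕ} (b : Fin m → ℕ) (i : ℕ) : ℕ := if h : i < m then b ⟨i, h⟩ else 0

@[simp] lemma extendZero_coe {m : ℕ} (b : Fin m → ℕ) (i : Fin m) : extendZero b i = b i := by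
  simp [extendZero]

lemma extendZero_of_lt {m : ℕ} (b : Fin m → ℕ) {i : ℕ} (h : i < m) :
    extendZero b i = b ⟨i, h⟩ := by
  simp [extendZero, h]

/-- The sequences `b 0, …, b N` interlacing with `a 0, …, a (N + 1)`. -/
def interlacing (N : ℕ) (a : ℕ → ℕ) : Finset (Fin (N + 1) → ℕ) :=
  Fintype.piFinset fun i => Icc (a i) (a (i + 1))

/-- The generating function of Gelfand–Tsetlin patterns with top row `a 0 ≤ ⋯ ≤ a N`, counted by
the sum of all entries below the top row. -/
def patternSum (q : K) : ℕ → (ℕ → ℕ) → K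
  | 0, _ => 1
  | N + 1, a => ∑ b ∈ interlacing N a, q ^ (∑ i, b i) * patternSum q N (extendZero b)

lemma patternSum_zero (q : K) (N : ℕ) : patternSum q N (fun _ => 0) = 1 := by
  induction N with
  | zero => rfl
  | succ N ih =>
    have h : interlacing N (fun _ => 0) = {fun _ => 0} := by
      simp [interlacing, Fintype.piFinset_singleton]
    have h' : extendZero (fun _ : Fin (N + 1) => 0) = fun _ => 0 := by
      ext i; simp [extendZero]
    simp [patternSum, h, h', ih]

/-- One branching step, up to a factor independent of the top row. -/
lemma patternSum_succ_mul (q : K) (N : ℕ) (C : K)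
    (ih : ∀ a : ℕ → ℕ, (∀ i < N, a i ≤ a (i + 1)) → patternSum q N a * C =
      (Matrix.vandermonde fun i : Fin (N + 1) => q ^ (a i + i)).det)
    (a : ℕ → ℕ) (ha : ∀ i < N + 1, a i ≤ a (i + 1)) :
    patternSum q (N + 1) a *
        (C * q ^ (∑ i : Fin (N + 1), (i : ℕ)) * ∏ j : Fin (N + 1), (q ^ (j + 1 : ℕ) - 1)) =
      (Matrix.vandermonde fun i : Fin (N + 2) => q ^ (a i + i)).det := by
  have step : ∀ b ∈ interlacing N a,
      q ^ (∑ i, b i) * patternSum q N (extendZero b) * (C * q ^ (∑ i : Fin (N + 1), (i : ℕ))) =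
        (Matrix.of fun i j : Fin (N + 1) => (q ^ (b i + i)) ^ (j + 1 : ℕ)).det := by
    intro b hb
    have hb' : ∀ i : Fin (N + 1), a i ≤ b i ∧ b i ≤ a (i + 1) := by
      simpa [interlacing] using hb
    have hmono : ∀ i < N, extendZero b i ≤ extendZero b (i + 1) := by
      intro i hi
      rw [extendZero_of_lt b (show i < N + 1 by omega),
        extendZero_of_lt b (show i + 1 < N + 1 by omega)]
      exact (hb' ⟨i, by omega⟩).2.trans (hb' ⟨i + 1, by omega⟩).1
    have h := ih _ hmono
    simp only [extendZero_coe] at h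
    have hdet := Matrix.det_mul_column (fun i : Fin (N + 1) => q ^ (b i + i))
      (Matrix.vandermonde fun i : Fin (N + 1) => q ^ (b i + i))
    simp only [Matrix.vandermonde_apply, ← pow_succ'] at hdet
    rw [hdet, ← h, prod_pow_eq_pow_sum, sum_add_distrib, pow_add]
    ring
  have hdet := Matrix.det_mul_row (fun j : Fin (N + 1) => q ^ (j + 1 : ℕ) - 1)
    (Matrix.of fun i j : Fin (N + 1) =>
      ∑ x ∈ Icc (a i) (a (i + 1)), (q ^ (x + i : ℕ)) ^ (j + 1 : ℕ))
  rw [patternSum, ← mul_assoc, sum_mul, sum_congr rfl step, interlacing,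
    sum_piFinset_det (N + 1) _ fun i j x => (q ^ (x + i : ℕ)) ^ (j + 1 : ℕ), mul_comm, ← hdet,
    ← det_pow_succ_sub_pow_succ (N + 1) fun i => q ^ (a i + i)]
  congr 1
  ext i j
  simp only [Matrix.of_apply]
  rw [mul_comm, sum_Icc_pow_mul q _ _ _ _ (ha i i.2)]

/-- The `q`-Weyl dimension formula for Gelfand–Tsetlin patterns. -/
theorem patternSum_mul_det (q : K) (N : ℕ) (a : ℕ → ℕ) (ha : ∀ i < N, a i ≤ a (i + 1)) :
    patternSum q N a * (Matrix.vandermonde fun i : Fin (N + 1) => q ^ (i : ℕ)).det =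
      (Matrix.vandermonde fun i : Fin (N + 1) => q ^ (a i + i)).det := by
  induction N generalizing a with
  | zero => simp [patternSum]
  | succ N ih =>
    have h := patternSum_succ_mul q N _ ih
    have h0 := h (fun _ => 0) (by simp)
    rw [patternSum_zero, one_mul] at h0
    simp only [zero_add] at h0
    rw [← h a ha, h0]

/-- Triangular arrays on `{(u, v) | u + v < N}`, weakly increasing in `u` and weakly decreasing
in `v`, whose longest antidiagonal interlaces with `a 0, …, a N`. -/
def triangularArrays (N : ℕ) (a : ℕ → ℕ) : Set (ℕ → ℕ → ℕ) :=
  {T | (∀ u v, N ≤ u + v → T u v = 0) ∧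
    (∀ u v, u + v + 1 = N → a u ≤ T u v ∧ T u v ≤ a (u + 1)) ∧
    ∀ u v, u + v + 1 < N → T u (v + 1) ≤ T u v ∧ T u v ≤ T (u + 1) v}

/-- The sum of the entries of a triangular array. -/
def triangularSum (N : ℕ) (T : ℕ → ℕ → ℕ) : ℕ := ∑ u ∈ range N, ∑ v ∈ range (N - u), T u v

/-- Add the antidiagonal `b` to a triangular array of size `N`. -/
def glueAntidiagonal (N : ℕ) (b : ℕ → ℕ) (T : ℕ → ℕ → ℕ) (u v : ℕ) : ℕ :=
  if u + v = N then b u else T u v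

lemma triangularSum_glueAntidiagonal (N : ℕ) (b : Fin (N + 1) → ℕ) (T : ℕ → ℕ → ℕ) :
    triangularSum (N + 1) (glueAntidiagonal N (extendZero b) T) =
      ∑ i, b i + triangularSum N T := by
  have h : ∀ u ∈ range (N + 1), ∑ v ∈ range (N + 1 - u), glueAntidiagonal N (extendZero b) T u v =
      extendZero b u + ∑ v ∈ range (N - u), T u v := by
    intro u hu
    rw [mem_range] at hu
    rw [show N + 1 - u = N - u + 1 by omega, sum_range_succ, add_comm]
    congr 1
    · simp [glueAntidiagonal, show u + (N - u) = N by omega]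
    · refine sum_congr rfl fun v hv => ?_
      rw [mem_range] at hv
      simp [glueAntidiagonal, show u + v ≠ N by omega]
  rw [triangularSum, sum_congr rfl h, sum_add_distrib, sum_range_succ (fun u => ∑ v ∈ _, T u v),
    ← Fin.sum_univ_eq_sum_range]
  simp [triangularSum]

lemma glueAntidiagonal_mem (N : ℕ) (a : ℕ → ℕ) (b : Fin (N + 1) → ℕ) (T : ℕ → ℕ → ℕ)
    (hb : b ∈ interlacing N a) (hT : T ∈ triangularArrays N (extendZero b)) :
    glueAntidiagonal N (extendZero b) T ∈ triangularArrays (N + 1) a := by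
  obtain ⟨h0, h1, h2⟩ := hT
  have hb' : ∀ i : Fin (N + 1), a i ≤ b i ∧ b i ≤ a (i + 1) := by
    simpa [interlacing] using hb
  refine ⟨fun u v h => ?_, fun u v h => ?_, fun u v h => ?_⟩
  · rw [glueAntidiagonal, if_neg (by omega), h0 u v (by omega)]
  · rw [glueAntidiagonal, if_pos (by omega), extendZero_of_lt b (show u < N + 1 by omega)]
    exact hb' ⟨u, by omega⟩
  · simp only [glueAntidiagonal, if_neg (show u + v ≠ N by omega)]
    by_cases huv : u + v + 1 = N
    · rw [if_pos (by omega), if_pos (by omega)]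
      exact h1 u v huv
    · rw [if_neg (by omega), if_neg (by omega)]
      exact h2 u v (by omega)

lemma exists_glueAntidiagonal_eq (N : ℕ) (a : ℕ → ℕ) (T : ℕ → ℕ → ℕ)
    (hT : T ∈ triangularArrays (N + 1) a) :
    ∃ b ∈ interlacing N a, ∃ T' ∈ triangularArrays N (extendZero b),
      glueAntidiagonal N (extendZero b) T' = T := by
  obtain ⟨h0, h1, h2⟩ := hT
  refine ⟨fun i => T i (N - i), ?_, fun u v => if u + v < N then T u v else 0,
    ⟨fun u v h => ?_, fun u v h => ?_, fun u v h => ?_⟩, ?_⟩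
  · simpa [interlacing] using fun i : Fin (N + 1) => h1 i (N - i) (by omega)
  · simp; omega
  · have := h2 u v (by omega)
    rw [extendZero_of_lt _ (show u < N + 1 by omega),
      extendZero_of_lt _ (show u + 1 < N + 1 by omega)]
    simpa [show u + v < N by omega, show N - u = v + 1 by omega,
      show N - (u + 1) = v by omega] using this
  · simp only [show u + (v + 1) < N by omega, show u + v < N by omega,
      show u + 1 + v < N by omega, if_true]
    exact h2 u v (by omega)
  · ext u v
    simp only [glueAntidiagonal]
    split_ifs with h h'
    · rw [extendZero_of_lt _ (show u < N + 1 by omega)]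
      simp [show N - u = v by omega]
    · rfl
    · exact (h0 u v (by omega)).symm

lemma glueAntidiagonal_injective (N : ℕ) (b b' : Fin (N + 1) → ℕ) (T T' : ℕ → ℕ → ℕ)
    (hT : T ∈ triangularArrays N (extendZero b)) (hT' : T' ∈ triangularArrays N (extendZero b'))
    (h : glueAntidiagonal N (extendZero b) T = glueAntidiagonal N (extendZero b') T') :
    b = b' ∧ T = T' := by
  constructor
  · ext i
    have := congr_fun₂ h i (N - i)
    simpa [glueAntidiagonal, show (i : ℕ) + (N - i) = N by omega] using this
  · ext u v
    by_cases huv : u + v = N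
    · rw [hT.1 u v huv.ge, hT'.1 u v huv.ge]
    · have := congr_fun₂ h u v
      simpa [glueAntidiagonal, huv] using this

/-- Triangular arrays are enumerated by `patternSum`. -/
theorem exists_finset_triangularArrays (q : K) (N : ℕ) (a : ℕ → ℕ) :
    ∃ S : Finset (ℕ → ℕ → ℕ), (S : Set (ℕ → ℕ → ℕ)) = triangularArrays N a ∧
      ∑ T ∈ S, q ^ triangularSum N T = patternSum q N a := by
  classical
  induction N generalizing a with
  | zero =>
    refine ⟨{fun _ _ => 0}, ?_, by simp [triangularSum, patternSum]⟩
    ext T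
    simp [triangularArrays, funext_iff]
  | succ N ih =>
    choose S hS hsum using ih
    have hmem : ∀ a T, T ∈ S a ↔ T ∈ triangularArrays N a := fun a T => by
      rw [← hS a, mem_coe]
    refine ⟨((interlacing N a).sigma fun b => S (extendZero b)).image fun p =>
      glueAntidiagonal N (extendZero p.1) p.2, ?_, ?_⟩
    · ext T
      simp only [coe_image, Set.mem_image, mem_coe, mem_sigma, hmem]
      constructor
      · rintro ⟨p, ⟨hb, hT⟩, rfl⟩
        exact glueAntidiagonal_mem N a p.1 p.2 hb hT
      · intro hT
        obtain ⟨b, hb, T', hT', rfl⟩ := exists_glueAntidiagonal_eq N a T hT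
        exact ⟨⟨b, T'⟩, ⟨hb, hT'⟩, rfl⟩
    · rw [sum_image, sum_sigma, patternSum]
      · refine sum_congr rfl fun b _ => ?_
        simp only [triangularSum_glueAntidiagonal, pow_add]
        rw [← mul_sum, hsum]
      · rintro ⟨b, T⟩ hp ⟨b', T'⟩ hp' h
        simp only [coe_sigma, Set.mem_sigma_iff, mem_coe, hmem] at hp hp'
        obtain ⟨rfl, rfl⟩ := glueAntidiagonal_injective N b b' T T' hp.2 hp'.2 h
        rfl

end TriangularArrays

section BoxedPlanePartitions

/-- The top row `0, …, 0, n, …, n` with `c` zeros. -/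
def boxTopRow (c n u : ℕ) : ℕ := if u < c then 0 else n

/-- The triangular array obtained from a plane partition in a box with `r + 1` rows and `c`
columns by adding the entries forced by the top row. -/
def toTriangularArray (r c n : ℕ) (π : ℕ → ℕ → ℕ) (u v : ℕ) : ℕ :=
  if u + v < r + c then if c ≤ u then n else π (v + 1) (c - u) else 0

lemma toTriangularArray_mem {r c n : ℕ} {π : ℕ → ℕ → ℕ} (hπ : π ∈ boxPP (r + 1) c n) :
    toTriangularArray r c n π ∈ triangularArrays (r + c) (boxTopRow c n) := by
  obtain ⟨⟨hrow, hcol, hout, -⟩, hle⟩ := hπ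
  refine ⟨fun u v h => ?_, fun u v h => ?_, fun u v h => ?_⟩
  · simp [toTriangularArray, show ¬ u + v < r + c by omega]
  · simp only [toTriangularArray, boxTopRow, show u + v < r + c by omega, if_true]
    by_cases hu : c ≤ u
    · simp [hu, show ¬ u < c by omega, show ¬ u + 1 < c by omega]
    · by_cases hu' : u + 1 < c
      · simp [hu, hu', hout (v + 1) (c - u) (by omega)]
      · simp [hu, hu', hle, lt_of_not_ge hu]
  · simp only [toTriangularArray, show u + v < r + c by omega, show u + (v + 1) < r + c by omega,
      show u + 1 + v < r + c by omega, if_true]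
    by_cases hu : c ≤ u
    · simp [hu, show c ≤ u + 1 by omega]
    · simp only [hu, if_false]
      refine ⟨hcol _ _ (by omega) (by omega), ?_⟩
      split_ifs with hu'
      · exact hle _ _
      · have := hrow (v + 1) (c - (u + 1)) (by omega) (by omega)
        rwa [show c - (u + 1) + 1 = c - u by omega] at this

lemma toTriangularArray_injOn (r c n : ℕ) :
    Set.InjOn (toTriangularArray r c n) (boxPP (r + 1) c n) := by
  rintro π ⟨⟨-, -, hout, hzero⟩, -⟩ π' ⟨⟨-, -, hout', hzero'⟩, -⟩ h
  ext i j
  by_cases hij : i = 0 ∨ j = 0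
  · rw [hzero i j hij, hzero' i j hij]
  by_cases hij' : r + 1 < i ∨ c < j
  · rw [hout i j hij', hout' i j hij']
  have := congr_fun₂ h (c - j) (i - 1)
  simpa [toTriangularArray, show c - j + (i - 1) < r + c by omega, show ¬ c ≤ c - j by omega,
    show i - 1 + 1 = i by omega, show c - (c - j) = j by omega] using this

lemma triangularArrays_boxTopRow_forced {r c n : ℕ} {T : ℕ → ℕ → ℕ}
    (hT : T ∈ triangularArrays (r + c) (boxTopRow c n)) (d u v : ℕ) (h : u + v + 1 + d = r + c) :
    T u v ≤ n ∧ (c ≤ u → T u v = n) ∧ (r < v → T u v = 0) := by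
  obtain ⟨-, h1, h2⟩ := hT
  induction d generalizing u v with
  | zero =>
    have := h1 u v h
    unfold boxTopRow at this
    grind
  | succ d ih =>
    have := h2 u v (by omega)
    have := ih u (v + 1) (by omega)
    have := ih (u + 1) v (by omega)
    grind

lemma exists_toTriangularArray_eq {r c n : ℕ} {T : ℕ → ℕ → ℕ}
    (hT : T ∈ triangularArrays (r + c) (boxTopRow c n)) :
    ∃ π ∈ boxPP (r + 1) c n, toTriangularArray r c n π = T := by
  have hf : ∀ u v, u + v < r + c → T u v ≤ n ∧ (c ≤ u → T u v = n) ∧ (r < v → T u v = 0) :=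
    fun u v h => triangularArrays_boxTopRow_forced hT (r + c - (u + v + 1)) u v (by omega)
  obtain ⟨h0, -, h2⟩ := hT
  refine ⟨fun i j => if (1 ≤ i ∧ i ≤ r + 1) ∧ 1 ≤ j ∧ j ≤ c then T (c - j) (i - 1) else 0,
    ⟨⟨fun i j hi hj => ?_, fun i j hi hj => ?_, fun i j h => ?_, fun i j h => ?_⟩,
      fun i j => ?_⟩, ?_⟩
  · dsimp only
    split_ifs with h h'
    · have := (h2 (c - (j + 1)) (i - 1) (by omega)).2
      rwa [show c - (j + 1) + 1 = c - j by omega] at this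
    · omega
    · exact Nat.zero_le _
    · exact le_rfl
  · dsimp only
    split_ifs with h h'
    · have := (h2 (c - j) (i - 1) (by omega)).1
      rwa [show i - 1 + 1 = i + 1 - 1 by omega] at this
    · omega
    · exact Nat.zero_le _
    · exact le_rfl
  · exact if_neg (by omega)
  · exact if_neg (by omega)
  · dsimp only
    split_ifs with h
    · exact (hf _ _ (by omega)).1
    · exact Nat.zero_le _
  · ext u v
    simp only [toTriangularArray]
    split_ifs with huv hu h
    · exact ((hf u v huv).2.1 hu).symm
    · rw [show c - (c - u) = u by omega, Nat.add_sub_cancel]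
    · exact ((hf u v huv).2.2 (by omega)).symm
    · exact (h0 u v (by omega)).symm

lemma ppNorm_eq_sum {r c : ℕ} {π : ℕ → ℕ → ℕ} (hπ : IsPlanePartition r c π) :
    ppNorm π = ∑ j ∈ range c, ∑ i ∈ range r, π (i + 1) (j + 1) := by
  obtain ⟨-, -, hout, hzero⟩ := hπ
  have hj : ∀ i, ∑ᶠ j, π i j = ∑ j ∈ range c, π i (j + 1) := by
    intro i
    rw [finsum_eq_sum_of_support_subset (s := range (c + 1)), sum_range_succ',
      hzero i 0 (by simp), add_zero]
    intro j hj
    by_contra h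
    exact hj (hout i j (by simp at h; omega))
  have hi : ∑ᶠ i, ∑ j ∈ range c, π i (j + 1) =
      ∑ i ∈ range r, ∑ j ∈ range c, π (i + 1) (j + 1) := by
    rw [finsum_eq_sum_of_support_subset (s := range (r + 1)), sum_range_succ',
      sum_eq_zero fun j _ => hzero 0 (j + 1) (by simp), add_zero]
    intro i hi
    by_contra h
    exact hi (sum_eq_zero fun j _ => hout i _ (by simp at h; omega))
  simp only [ppNorm, hj]
  rw [hi, sum_comm]

lemma triangularSum_toTriangularArray {r c n : ℕ} {π : ℕ → ℕ → ℕ}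
    (hπ : π ∈ boxPP (r + 1) c n) :
    triangularSum (r + c) (toTriangularArray r c n π) =
      ppNorm π + ∑ j ∈ range (r + 1), n * j := by
  have hfree : ∀ u ∈ range c, ∑ v ∈ range (c + r - u), toTriangularArray r c n π u v =
      ∑ i ∈ range (r + 1), π (i + 1) (c - 1 - u + 1) := by
    intro u hu
    rw [mem_range] at hu
    rw [show c + r - u = (r + 1) + (c - 1 - u) by omega, sum_range_add,
      sum_eq_zero (s := range (c - 1 - u)), add_zero]
    · refine sum_congr rfl fun v hv => ?_
      rw [mem_range] at hv
      simp [toTriangularArray, show u + v < r + c by omega, show ¬ c ≤ u by omega,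
        show c - 1 - u + 1 = c - u by omega]
    · intro v _
      have := hπ.1.2.2.1 (r + 1 + v + 1) (c - u) (by omega)
      simp [toTriangularArray, show ¬ c ≤ u by omega, this]
  have hforced : ∀ u ∈ range r,
      ∑ v ∈ range (c + r - (c + u)), toTriangularArray r c n π (c + u) v =
        n * (r - 1 - u + 1) := by
    intro u hu
    rw [mem_range] at hu
    rw [show c + r - (c + u) = r - 1 - u + 1 by omega, sum_congr rfl (g := fun _ => n)]
    · simp [mul_comm]
    · intro v hv
      rw [mem_range] at hv
      simp [toTriangularArray, show c + u + v < r + c by omega]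
  rw [ppNorm_eq_sum hπ.1, triangularSum, add_comm r c, sum_range_add, sum_congr rfl hfree,
    sum_congr rfl hforced, sum_range_reflect (fun u => ∑ i ∈ range (r + 1), π (i + 1) (u + 1)),
    sum_range_reflect (fun u => n * (u + 1)), sum_range_succ' _ r]
  simp

/-- The generating function of plane partitions in a box as a Gelfand–Tsetlin pattern sum. -/
lemma finsum_boxPP_mul_pow {K : Type*} [Field K] (q : K) (r c n : ℕ) :
    (∑ᶠ π ∈ boxPP (r + 1) c n, q ^ ppNorm π) * q ^ (∑ j ∈ range (r + 1), n * j) =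
      patternSum q (r + c) (boxTopRow c n) := by
  obtain ⟨S, hS, hsum⟩ := exists_finset_triangularArrays q (r + c) (boxTopRow c n)
  have hbij : Set.BijOn (toTriangularArray r c n) (boxPP (r + 1) c n) (S : Set (ℕ → ℕ → ℕ)) := by
    rw [hS]
    exact ⟨fun π hπ => toTriangularArray_mem hπ, toTriangularArray_injOn r c n,
      fun T hT => exists_toTriangularArray_eq hT⟩
  rw [← hsum, ← finsum_mem_coe_finset _ S, finsum_mem_mul]
  refine finsum_mem_eq_of_bijOn _ hbij fun π hπ => ?_
  rw [triangularSum_toTriangularArray hπ, pow_add]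

end BoxedPlanePartitions

section Product

variable {K : Type*} [Field K]

lemma prod_range_sub_split (c r : ℕ) (y : ℕ → K) :
    ∏ j ∈ range (c + r), ∏ i ∈ range j, (y j - y i) =
      (∏ j ∈ range c, ∏ i ∈ range j, (y j - y i)) *
        ((∏ j ∈ range r, ∏ i ∈ range c, (y (c + j) - y i)) *
          ∏ j ∈ range r, ∏ i ∈ range j, (y (c + j) - y (c + i))) := by
  rw [prod_range_add, ← prod_mul_distrib]
  simp only [prod_range_add]

lemma prod_boxTopRow_sub (q : K) (c r n : ℕ) :
    ∏ j ∈ range (c + r), ∏ i ∈ range j,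
        (q ^ (boxTopRow c n j + j) - q ^ (boxTopRow c n i + i)) =
      (∏ j ∈ range c, ∏ i ∈ range j, (q ^ j - q ^ i)) *
        ((∏ j ∈ range r, ∏ i ∈ range c, (q ^ (n + (c + j)) - q ^ i)) *
          (q ^ (∑ j ∈ range r, n * j) *
            ∏ j ∈ range r, ∏ i ∈ range j, (q ^ (c + j) - q ^ (c + i)))) := by
  rw [prod_range_sub_split c r fun j => q ^ (boxTopRow c n j + j)]
  congr 1
  · refine prod_congr rfl fun j hj => prod_congr rfl fun i hi => ?_
    rw [mem_range] at hi hj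
    simp [boxTopRow, hj, hi.trans hj]
  congr 1
  · refine prod_congr rfl fun j _ => prod_congr rfl fun i hi => ?_
    rw [mem_range] at hi
    simp [boxTopRow, hi]
  · rw [← prod_pow_eq_pow_sum, ← prod_mul_distrib]
    refine prod_congr rfl fun j _ => ?_
    rw [pow_mul, ← card_range j, ← prod_const, card_range, ← prod_mul_distrib]
    refine prod_congr rfl fun i _ => ?_
    simp [boxTopRow, pow_add]
    ring

lemma prod_Icc_one_eq_prod_range (m : ℕ) (f : ℕ → K) :
    ∏ i ∈ Icc 1 m, f i = ∏ i ∈ range m, f (i + 1) := by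
  induction m with
  | zero => simp
  | succ m ih => rw [prod_Icc_succ_top (by omega), ih, prod_range_succ]

/-- MacMahon's product in terms of differences of powers. -/
lemma prod_box_eq_div (q : K) (hq0 : q ≠ 0) (hq : ∀ m, 0 < m → q ^ m ≠ 1) (r c n : ℕ) :
    ∏ i ∈ Icc 1 r, ∏ j ∈ Icc 1 c, ∏ k ∈ Icc 1 n,
        (1 - q ^ (i + j + k - 1)) / (1 - q ^ (i + j + k - 2)) =
      (∏ j ∈ range r, ∏ i ∈ range c, (q ^ (n + (c + j)) - q ^ i)) /
        ∏ j ∈ range r, ∏ i ∈ range c, (q ^ (c + j) - q ^ i) := by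
  have hne : ∀ m, 1 - q ^ (m + 1) ≠ 0 := fun m => sub_ne_zero.2 (hq _ (by omega)).symm
  have htel : ∀ m, ∏ k ∈ Icc 1 n, (1 - q ^ (m + k + 1)) / (1 - q ^ (m + k)) =
      (1 - q ^ (m + n + 1)) / (1 - q ^ (m + 1)) := by
    intro m
    induction n with
    | zero => simp [div_self (hne m)]
    | succ n ih =>
      rw [prod_Icc_succ_top (by omega), ih, ← add_assoc m n 1, mul_comm,
        div_mul_div_cancel₀ (hne _)]
  simp only [← Finset.prod_div_distrib]
  rw [prod_Icc_one_eq_prod_range]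
  refine prod_congr rfl fun i _ => ?_
  rw [prod_Icc_one_eq_prod_range, ← prod_range_reflect]
  refine prod_congr rfl fun j hj => ?_
  rw [mem_range] at hj
  have hidx : i + 1 + (c - 1 - j + 1) = i + (c - j) + 1 := by omega
  rw [hidx]
  calc _ = ∏ k ∈ Icc 1 n, (1 - q ^ (i + (c - j) - 1 + k + 1)) / (1 - q ^ (i + (c - j) - 1 + k)) :=
        prod_congr rfl fun k _ => by
          rw [show i + (c - j) + 1 + k - 1 = i + (c - j) - 1 + k + 1 by omega,
            show i + (c - j) + 1 + k - 2 = i + (c - j) - 1 + k by omega]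
    _ = (1 - q ^ (i + (c - j) - 1 + n + 1)) / (1 - q ^ (i + (c - j) - 1 + 1)) := htel _
    _ = _ := by
      rw [show n + (c + i) = j + (i + (c - j) - 1 + n + 1) by omega,
        show c + i = j + (i + (c - j) - 1 + 1) by omega, pow_add q j, pow_add q j,
        ← neg_div_neg_eq, neg_sub, neg_sub, ← mul_div_mul_left _ _ (pow_ne_zero j hq0)]
      ring_nf

end Product

lemma RatFunc.X_pow_ne_one {m : ℕ} (hm : 0 < m) : (RatFunc.X : RatFunc ℚ) ^ m ≠ 1 := by
  intro h
  rw [← RatFunc.algebraMap_X, ← map_pow, ← map_one (algebraMap (Polynomial ℚ) (RatFunc ℚ))] at h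
  have := congr_arg Polynomial.natDegree (RatFunc.algebraMap_injective ℚ h)
  simp at this
  omega

lemma boxPP_zero_left (c n : ℕ) : boxPP 0 c n = {fun _ _ => 0} := by
  ext π
  rw [Set.mem_singleton_iff]
  constructor
  · rintro ⟨⟨-, -, hout, hzero⟩, -⟩
    ext i j
    rcases Nat.eq_zero_or_pos i with hi | hi
    · exact hzero i j (Or.inl hi)
    · exact hout i j (Or.inl hi)
  · rintro rfl
    simp [boxPP, IsPlanePartition]

/-- **MacMahon's box formula**: for all nonnegative integers `r, c, n`, in `ℚ(q)`,
`Σ_{π ∈ P(r,c,n)} q^{|π|} = ∏_{i=1}^r ∏_{j=1}^c ∏_{k=1}^n (1 - q^{i+j+k-1})/(1 - q^{i+j+k-2})`. -/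
theorem macmahon_box (r c n : ℕ) :
    (∑ᶠ π ∈ boxPP r c n, (RatFunc.X : RatFunc ℚ) ^ ppNorm π) =
    ∏ i ∈ Finset.Icc 1 r, ∏ j ∈ Finset.Icc 1 c, ∏ k ∈ Finset.Icc 1 n,
      (1 - (RatFunc.X : RatFunc ℚ) ^ (i + j + k - 1)) /
        (1 - (RatFunc.X : RatFunc ℚ) ^ (i + j + k - 2)) := by
  rcases r with _ | r
  · rw [boxPP_zero_left, finsum_mem_singleton]
    simp [ppNorm]
  set q : RatFunc ℚ := RatFunc.X
  have hq0 : q ≠ 0 := RatFunc.X_ne_zero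
  have hq : ∀ m, 0 < m → q ^ m ≠ 1 := fun m => RatFunc.X_pow_ne_one
  have hsub : ∀ i j, i < j → q ^ j - q ^ i ≠ 0 := by
    intro i j hij h
    obtain ⟨d, rfl⟩ := Nat.exists_eq_add_of_lt hij
    rw [add_assoc, pow_add, sub_eq_zero, mul_eq_left₀ (pow_ne_zero i hq0)] at h
    exact hq _ (by omega) h
  have hlow : ∏ j ∈ range c, ∏ i ∈ range j, (q ^ j - q ^ i) ≠ 0 :=
    prod_ne_zero_iff.2 fun j _ => prod_ne_zero_iff.2 fun i hi => hsub i j (mem_range.1 hi)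
  have hmid : ∏ j ∈ range (r + 1), ∏ i ∈ range c, (q ^ (c + j) - q ^ i) ≠ 0 :=
    prod_ne_zero_iff.2 fun j _ => prod_ne_zero_iff.2 fun i hi =>
      hsub i _ (by have := mem_range.1 hi; omega)
  have hhigh : ∏ j ∈ range (r + 1), ∏ i ∈ range j, (q ^ (c + j) - q ^ (c + i)) ≠ 0 :=
    prod_ne_zero_iff.2 fun j _ => prod_ne_zero_iff.2 fun i hi =>
      hsub _ _ (by have := mem_range.1 hi; omega)
  have hpow : q ^ (∑ j ∈ range (r + 1), n * j) ≠ 0 := pow_ne_zero _ hq0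
  have h := patternSum_mul_det q (r + c) (boxTopRow c n) fun i _ => by
    unfold boxTopRow
    split_ifs <;> omega
  rw [← finsum_boxPP_mul_pow, det_vandermonde_eq_prod_range _ fun i => q ^ i,
    det_vandermonde_eq_prod_range _ fun i => q ^ (boxTopRow c n i + i),
    show r + c + 1 = c + (r + 1) by omega, prod_boxTopRow_sub,
    prod_range_sub_split c (r + 1) fun i => q ^ i] at h
  rw [prod_box_eq_div q hq0 hq, eq_div_iff hmid]
  refine mul_right_cancel₀ (mul_ne_zero (mul_ne_zero hlow hpow) hhigh) ?_
  linear_combination h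

end
end

section
/- First ratio simplification in the recurrence check: for all integers r, c, n with 1 ≤ r < c and n ≥ 1, the following identity holds in ℚ(a,q): [φ(r-1,c,n) / φ(r,c,n)] · [φ(r,c-1,n) / φ(r-1,c-1,n)] = q^{n+r-1} · (1 - a q^{r+c-1}) / (1 - a q^{r+c+n-1}). -/
open Finset

noncomputable section

/-- The field `ℚ(a,q)` of rational functions in two indeterminates over `ℚ`. -/
abbrev Kaq : Type := FractionRing (MvPolynomial (Fin 2) ℚ)

/-- The indeterminate `a` in `ℚ(a,q)`. -/
def av : Kaq := algebraMap (MvPolynomial (Fin 2) ℚ) Kaq (MvPolynomial.X 0)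

/-- The indeterminate `q` in `ℚ(a,q)`. -/
def qv : Kaq := algebraMap (MvPolynomial (Fin 2) ℚ) Kaq (MvPolynomial.X 1)

/-- The q-Pochhammer symbol `(x; q)_N = ∏_{m=0}^{N-1} (1 - x qᵐ)`. -/
def poch {K : Type*} [Field K] (x q : K) (N : ℕ) : K :=
  ∏ m ∈ Finset.range N, (1 - x * q ^ m)

/-- `A(r,c,n) = ∏_{i=1}^{min(r,c)} (a q^{n+i-1}; q⁻¹)_{i-1} / (q^{n+i-1}; q⁻¹)_{i-1}`. -/
def Afun (r c n : ℕ) : Kaq :=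
  ∏ i ∈ Finset.Icc 1 (min r c),
    poch (av * qv ^ (n + i - 1)) qv⁻¹ (i - 1) / poch (qv ^ (n + i - 1)) qv⁻¹ (i - 1)

/-- The explicit product
`φ(r,c,n) = a^{-d(d+1)/2 - (n+1)d} q^{-c(r(r+1)/2 + (n-1)r)} A(r,c,n)`
`· ∏_{i=1}^r ∏_{j=1}^c ∏_{k=1}^n (1 - a q^{i+j+k-1})/(1 - a q^{i+j+k-2})`,
where `d = min(r,c)`. -/
def phi (r c n : ℕ) : Kaq :=
  av ^ (-((min r c : ℤ) * ((min r c : ℤ) + 1) / 2 + ((n : ℤ) + 1) * (min r c : ℤ))) *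
  qv ^ (-((c : ℤ) * ((r : ℤ) * ((r : ℤ) + 1) / 2 + ((n : ℤ) - 1) * (r : ℤ)))) *
  Afun r c n *
  ∏ i ∈ Finset.Icc 1 r, ∏ j ∈ Finset.Icc 1 c, ∏ k ∈ Finset.Icc 1 n,
    (1 - av * qv ^ (i + j + k - 1)) / (1 - av * qv ^ (i + j + k - 2))

theorem one_sub_algebraMap_ne_zero {p : MvPolynomial (Fin 2) ℚ} (i : Fin 2)
    (hp : MvPolynomial.X i ∣ p) : (1 : Kaq) - algebraMap (MvPolynomial (Fin 2) ℚ) Kaq p ≠ 0 := by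
  obtain ⟨s, rfl⟩ := hp
  rw [sub_ne_zero, ← map_one (algebraMap (MvPolynomial (Fin 2) ℚ) Kaq)]
  intro h
  have h' := congrArg (MvPolynomial.eval (0 : Fin 2 → ℚ))
    (IsFractionRing.injective (MvPolynomial (Fin 2) ℚ) Kaq h)
  simp at h'

theorem av_ne_zero : av ≠ 0 := by
  simp [av, MvPolynomial.X_ne_zero]

theorem qv_ne_zero : qv ≠ 0 := by
  simp [qv, MvPolynomial.X_ne_zero]

theorem one_sub_av_mul_qv_pow_ne_zero (m : ℕ) : 1 - av * qv ^ m ≠ 0 := by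
  have h := one_sub_algebraMap_ne_zero 0 (dvd_mul_right (MvPolynomial.X 0)
    (MvPolynomial.X 1 ^ m : MvPolynomial (Fin 2) ℚ))
  rwa [map_mul, map_pow] at h

theorem one_sub_qv_pow_ne_zero {m : ℕ} (hm : m ≠ 0) : 1 - qv ^ m ≠ 0 := by
  have h := one_sub_algebraMap_ne_zero 1 (dvd_pow_self
    (MvPolynomial.X 1 : MvPolynomial (Fin 2) ℚ) hm)
  rwa [map_pow] at h

theorem qv_pow_mul_inv_pow {k m : ℕ} (h : m ≤ k) : qv ^ k * qv⁻¹ ^ m = qv ^ (k - m) := by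
  rw [pow_sub₀ _ qv_ne_zero h, inv_pow]

theorem Afun_ne_zero (r c n : ℕ) (hn : 1 ≤ n) : Afun r c n ≠ 0 := by
  refine prod_ne_zero_iff.2 fun i _ => div_ne_zero ?_ ?_ <;>
    refine prod_ne_zero_iff.2 fun m hm => ?_ <;> rw [mem_range] at hm
  · rw [mul_assoc, qv_pow_mul_inv_pow (by omega)]
    exact one_sub_av_mul_qv_pow_ne_zero _
  · rw [qv_pow_mul_inv_pow (by omega)]
    exact one_sub_qv_pow_ne_zero (by omega)

theorem Afun_congr_min {r c c' : ℕ} (n : ℕ) (h : min r c = min r c') :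
    Afun r c n = Afun r c' n := by
  rw [Afun, Afun, h]

/-- The triple product over the box `[1,r] × [1,c] × [1,n]` occurring in `phi`. -/
def boxProd (r c n : ℕ) : Kaq :=
  ∏ i ∈ Finset.Icc 1 r, ∏ j ∈ Finset.Icc 1 c, ∏ k ∈ Finset.Icc 1 n,
    (1 - av * qv ^ (i + j + k - 1)) / (1 - av * qv ^ (i + j + k - 2))

theorem boxProd_ne_zero (r c n : ℕ) : boxProd r c n ≠ 0 :=
  prod_ne_zero_iff.2 fun _ _ => prod_ne_zero_iff.2 fun _ _ => prod_ne_zero_iff.2 fun _ _ =>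
    div_ne_zero (one_sub_av_mul_qv_pow_ne_zero _) (one_sub_av_mul_qv_pow_ne_zero _)

theorem prod_Icc_telescope (t n : ℕ) :
    ∏ k ∈ Finset.Icc 1 n, (1 - av * qv ^ (t + 2 + k - 1)) / (1 - av * qv ^ (t + 2 + k - 2)) =
      (1 - av * qv ^ (t + 1 + n)) / (1 - av * qv ^ (t + 1)) := by
  induction n with
  | zero => simp [div_self (one_sub_av_mul_qv_pow_ne_zero (t + 1))]
  | succ n ih =>
    rw [prod_Icc_succ_top (by omega), ih,
      show t + 2 + (n + 1) - 1 = t + 1 + (n + 1) by omega,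
      show t + 2 + (n + 1) - 2 = t + 1 + n by omega, mul_comm,
      div_mul_div_cancel₀ (one_sub_av_mul_qv_pow_ne_zero _)]

theorem boxProd_succ_succ (r c n : ℕ) :
    boxProd (r + 1) (c + 1) n * boxProd r c n = boxProd (r + 1) c n * boxProd r (c + 1) n *
      ((1 - av * qv ^ (r + c + 1 + n)) / (1 - av * qv ^ (r + c + 1))) := by
  have row (c' : ℕ) : boxProd (r + 1) c' n = boxProd r c' n * ∏ j ∈ Finset.Icc 1 c',
      ∏ k ∈ Finset.Icc 1 n,
        (1 - av * qv ^ (r + 1 + j + k - 1)) / (1 - av * qv ^ (r + 1 + j + k - 2)) :=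
    prod_Icc_succ_top (by omega) _
  rw [row, row, prod_Icc_succ_top (by omega), show r + 1 + (c + 1) = r + c + 2 by omega,
    prod_Icc_telescope]
  ring

theorem phi_eq_of_le {r c : ℕ} (n : ℕ) (h : r ≤ c) :
    phi r c n = av ^ (-((r : ℤ) * ((r : ℤ) + 1) / 2 + ((n : ℤ) + 1) * (r : ℤ))) *
      qv ^ (-((c : ℤ) * ((r : ℤ) * ((r : ℤ) + 1) / 2 + ((n : ℤ) - 1) * (r : ℤ)))) *
      Afun r r n * boxProd r c n := by
  rw [phi, Afun_congr_min (c' := r) n (by omega), min_eq_left (by exact_mod_cast h), boxProd]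

theorem triangular_succ (r : ℤ) : (r + 1) * (r + 1 + 1) / 2 = r * (r + 1) / 2 + (r + 1) := by
  rw [show (r + 1) * (r + 1 + 1) = r * (r + 1) + (r + 1) * 2 by ring,
    Int.add_mul_ediv_right _ _ two_ne_zero]

/-- **First ratio simplification in the recurrence check**: for `1 ≤ r < c` and `n ≥ 1`,
`[φ(r-1,c,n)/φ(r,c,n)] · [φ(r,c-1,n)/φ(r-1,c-1,n)]`
`= q^{n+r-1} (1 - a q^{r+c-1})/(1 - a q^{r+c+n-1})` in `ℚ(a,q)`. -/
theorem phi_first_ratio (r c n : ℕ) (hr : 1 ≤ r) (hrc : r < c) (hn : 1 ≤ n) :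
    phi (r - 1) c n / phi r c n * (phi r (c - 1) n / phi (r - 1) (c - 1) n) =
      qv ^ (n + r - 1) * (1 - av * qv ^ (r + c - 1)) / (1 - av * qv ^ (r + c + n - 1)) := by
  obtain ⟨s, rfl⟩ := Nat.exists_eq_add_of_le' hr
  obtain ⟨d, rfl⟩ := Nat.exists_eq_add_of_le' (show 1 ≤ c by omega)
  simp only [Nat.add_sub_cancel]
  rw [phi_eq_of_le n (by omega : s ≤ d + 1), phi_eq_of_le n (by omega : s + 1 ≤ d + 1),
    phi_eq_of_le n (by omega : s + 1 ≤ d), phi_eq_of_le n (by omega : s ≤ d),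
    show n + (s + 1) - 1 = n + s by omega, show s + 1 + (d + 1) - 1 = s + d + 1 by omega,
    show s + 1 + (d + 1) + n - 1 = s + d + 1 + n by omega]
  have hbox := boxProd_succ_succ s d n
  have hA := Afun_ne_zero s s n hn
  have hA' := Afun_ne_zero (s + 1) (s + 1) n hn
  have hx := one_sub_av_mul_qv_pow_ne_zero (s + d + 1)
  have hy := one_sub_av_mul_qv_pow_ne_zero (s + d + 1 + n)
  have h₁ := boxProd_ne_zero s d n
  have h₂ := boxProd_ne_zero (s + 1) (d + 1) n
  push_cast
  rw [triangular_succ]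
  generalize (s : ℤ) * ((s : ℤ) + 1) / 2 = t
  have hq : qv ^ (-(((d : ℤ) + 1) * (t + (n - 1) * s))) *
      qv ^ (-((d : ℤ) * (t + (s + 1) + (n - 1) * (s + 1)))) =
      qv ^ (n + s) * (qv ^ (-(((d : ℤ) + 1) * (t + (s + 1) + (n - 1) * (s + 1)))) *
      qv ^ (-((d : ℤ) * (t + (n - 1) * s)))) := by
    rw [← zpow_natCast, ← zpow_add₀ qv_ne_zero, ← zpow_add₀ qv_ne_zero, ← zpow_add₀ qv_ne_zero]
    congr 1
    push_cast
    ring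
  have ha₁ := zpow_ne_zero (-(t + ((n : ℤ) + 1) * s)) av_ne_zero
  have ha₂ := zpow_ne_zero (-(t + ((s : ℤ) + 1) + ((n : ℤ) + 1) * (s + 1))) av_ne_zero
  have hq₁ := zpow_ne_zero (-(((d : ℤ) + 1) * (t + (s + 1) + (n - 1) * (s + 1)))) qv_ne_zero
  have hq₂ := zpow_ne_zero (-((d : ℤ) * (t + (n - 1) * s))) qv_ne_zero
  generalize av ^ (-(t + ((n : ℤ) + 1) * s)) = a₁ at *
  generalize av ^ (-(t + ((s : ℤ) + 1) + ((n : ℤ) + 1) * (s + 1))) = a₂ at *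
  generalize qv ^ (-(((d : ℤ) + 1) * (t + (s + 1) + (n - 1) * (s + 1)))) = q₁ at *
  generalize qv ^ (-((d : ℤ) * (t + (n - 1) * s))) = q₂ at *
  generalize qv ^ (-(((d : ℤ) + 1) * (t + (n - 1) * s))) = q₃ at *
  generalize qv ^ (-((d : ℤ) * (t + (s + 1) + (n - 1) * (s + 1)))) = q₄ at *
  generalize 1 - av * qv ^ (s + d + 1) = x at *
  generalize 1 - av * qv ^ (s + d + 1 + n) = y at *
  rw [← mul_div_assoc, eq_div_iff hx] at hbox
  rw [div_mul_div_comm, div_eq_div_iff (by positivity) hy]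
  linear_combination (a₁ * a₂ * Afun s s n * Afun (s + 1) (s + 1) n) *
    (boxProd s (d + 1) n * boxProd (s + 1) d n * y * hq -
      qv ^ (n + s) * q₁ * q₂ * hbox)

end
end
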